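/- For every integer s ≥ 3, there is no bipartite graph G with parts V₁ and V₂ such that |V₁| = s²−1, |V₂| = s³−s, every vertex of V₁ has degree s², every vertex of V₂ has degree s, and G has diameter 3. In other words, no [s²,s;3]-bigraph attains the Moore bound M(s²,s;3) = (s²−1) + (s³−s). -/

import Mathlib

open Matrix in
/-- A symmetric real matrix `K` with entries at least `1`, constant diagonal `d > 2` and
constant row sum `card ι + d`, is nondegenerate. -/
theorem eq_zero_of_mulVec_eq_zero_of_one_le {ι : Type*} [Fintype ι] {K : Matrix ι ι ℝ}
    {d : ℝ} (hd : 2 < d) (hsymm : ∀ i j, K i j = K j i) (hdiag : ∀ i, K i i = d)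
    (hone : ∀ i j, 1 ≤ K i j) (hrow : ∀ i, ∑ j, K i j = Fintype.card ι + d)
    {x : ι → ℝ} (hx : K *ᵥ x = 0) : x = 0 := by
  classical
  have hker : ∀ i, ∑ j, K i j * x j = 0 := fun i => congrFun hx i
  have hsum : ∑ j, x j = 0 := by
    have h : ∑ j, ((Fintype.card ι : ℝ) + d) * x j = 0 := by
      calc ∑ j, ((Fintype.card ι : ℝ) + d) * x j = ∑ j, ∑ i, K i j * x j := by
            refine Finset.sum_congr rfl fun j _ => ?_
            rw [← Finset.sum_mul, ← hrow j]
            simp only [hsymm j]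
        _ = 0 := by rw [Finset.sum_comm]; simp [hker]
    rw [← Finset.mul_sum] at h
    have : (0 : ℝ) ≤ Fintype.card ι := by positivity
    exact (mul_eq_zero.mp h).resolve_left (by linarith)
  have hdet : (Matrix.of fun i j => K i j - 1).det ≠ 0 := by
    refine det_ne_zero_of_sum_row_lt_diag fun i => ?_
    have hnorm : ∀ j, ‖Matrix.of (fun i j => K i j - 1) i j‖ = K i j - 1 := fun j => by
      simp only [of_apply, Real.norm_eq_abs]
      exact abs_of_nonneg (by linarith [hone i j])
    simp only [hnorm]
    have h := Finset.add_sum_erase Finset.univ (fun j => K i j - 1) (Finset.mem_univ i)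
    simp only [Finset.sum_sub_distrib, hrow, hdiag] at h ⊢
    simp only [Finset.sum_const, Finset.card_univ, nsmul_eq_mul, mul_one] at h ⊢
    linarith
  refine eq_zero_of_mulVec_eq_zero hdet (funext fun i => ?_)
  simp [mulVec, dotProduct, sub_mul, hsum, hker]

open Matrix in
/-- An incidence structure whose blocks have size `s ≥ 3` and pairwise intersect, and where
each point lies on `r` blocks, has at least as many points as blocks when the number of blocks is
`s * r - s`. -/
theorem card_blocks_le_card_points {ι κ : Type*} [Fintype ι] [Fintype κ]
    (R : ι → κ → Prop) [∀ i p, Decidable (R i p)] {s r : ℕ} (hs : 3 ≤ s)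
    (hblock : ∀ i, (Finset.univ.filter fun p => R i p).card = s)
    (hpoint : ∀ p, (Finset.univ.filter fun i => R i p).card = r)
    (hmeet : ∀ i j, ∃ p, R i p ∧ R j p)
    (hcard : Fintype.card ι + s = s * r) : Fintype.card ι ≤ Fintype.card κ := by
  classical
  by_contra! hlt
  let N : Matrix ι κ ℝ := Matrix.of fun i p => if R i p then 1 else 0
  have hentry : ∀ i j, (N * Nᵀ) i j = ∑ p, if R i p ∧ R j p then (1 : ℝ) else 0 := fun i j => by
    simp only [mul_apply, transpose_apply, N, of_apply, ite_and, mul_ite, mul_one, mul_zero]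
    exact Finset.sum_congr rfl fun p _ => by split_ifs <;> rfl
  obtain ⟨x, hx, hx0⟩ := Submodule.exists_mem_ne_zero_of_ne_bot
    (LinearMap.ker_ne_bot_of_finrank_lt (f := Nᵀ.mulVecLin) (by simpa using hlt))
  refine hx0 (eq_zero_of_mulVec_eq_zero_of_one_le (K := N * Nᵀ) (d := s)
    (by exact_mod_cast hs) (fun i j => ?_) (fun i => ?_) (fun i j => ?_) (fun i => ?_) ?_)
  · simp only [hentry, and_comm]
  · rw [hentry]
    simp [hblock i]
  · obtain ⟨p, hp⟩ := hmeet i j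
    rw [hentry, Finset.sum_boole]
    exact_mod_cast Finset.card_pos.mpr ⟨p, by simpa using hp⟩
  · have h : ∀ p, ∑ j, (if R i p ∧ R j p then (1 : ℝ) else 0) = if R i p then (r : ℝ) else 0 := by
      intro p
      by_cases hp : R i p <;> simp [hp, hpoint p]
    simp only [hentry]
    rw [Finset.sum_comm]
    simp only [h]
    rw [← Finset.sum_filter, Finset.sum_const, hblock, nsmul_eq_mul]
    exact_mod_cast hcard.symm
  · rw [← mulVec_mulVec]
    have : Nᵀ *ᵥ x = 0 := hx
    rw [this, mulVec_zero]

/-- For `s ≥ 3`, there is no bipartite graph with parts `V1` (size `s²-1`, degrees `s²`) and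
`V2` (size `s³-s`, degrees `s`) of diameter 3; i.e., no `[s²,s;3]`-bigraph attains the Moore
bound `M(s²,s;3) = (s²-1) + (s³-s)`. -/
theorem stmt_4 {V : Type*} [Fintype V] (G : SimpleGraph V) [DecidableRel G.Adj]
    (V1 V2 : Finset V) (s : ℕ) (hs : 3 ≤ s)
    (hpart : ∀ v : V, v ∈ V1 ↔ v ∉ V2)
    (hbip : ∀ u v : V, G.Adj u v → (u ∈ V1 ∧ v ∈ V2) ∨ (u ∈ V2 ∧ v ∈ V1))
    (hcard1 : V1.card = s ^ 2 - 1) (hcard2 : V2.card = s ^ 3 - s)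
    (hdeg1 : ∀ v ∈ V1, G.degree v = s ^ 2)
    (hdeg2 : ∀ v ∈ V2, G.degree v = s)
    (hdiam : G.diam = 3) :
    False := by
  classical
  have h21 : ∀ u ∈ V2, ∀ v, G.Adj u v → v ∈ V1 := fun u hu v h => by
    have := hbip u v h; have := hpart u; tauto
  have h12 : ∀ u ∈ V1, ∀ v, G.Adj u v → v ∈ V2 := fun u hu v h => by
    have := hbip u v h; have := hpart u; tauto
  have hcube : s ≤ s ^ 3 := Nat.le_self_pow (by norm_num) s
  have htop : G.ediam ≠ ⊤ := fun h => by
    simp [SimpleGraph.diam, h] at hdiam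
  have key := card_blocks_le_card_points (ι := V2) (κ := V1)
    (fun i p => G.Adj i p) (s := s) (r := s ^ 2) hs ?_ ?_ ?_ ?_
  · simp only [Fintype.card_coe, hcard1, hcard2] at key
    have : 1 ≤ s ^ 2 := Nat.one_le_pow _ _ (by omega)
    zify [hcube, this] at key hs
    nlinarith [mul_nonneg (sub_nonneg.mpr hs) (sq_nonneg (s : ℤ)),
      mul_nonneg (sub_nonneg.mpr hs) (sub_nonneg.mpr hs)]
  · rintro ⟨i, hi⟩
    rw [← hdeg2 i hi, ← SimpleGraph.card_neighborFinset_eq_degree]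
    refine Finset.card_bij (fun p _ => p.1) (fun p hp => by simpa using hp)
      (fun _ _ _ _ h => Subtype.ext h) fun p hp => ?_
    rw [SimpleGraph.mem_neighborFinset] at hp
    exact ⟨⟨p, h21 i hi p hp⟩, by simpa using hp, rfl⟩
  · rintro ⟨p, hp⟩
    rw [← hdeg1 p hp, ← SimpleGraph.card_neighborFinset_eq_degree]
    refine Finset.card_bij (fun i _ => i.1) (fun i hi => by simpa [G.adj_comm] using hi)
      (fun _ _ _ _ h => Subtype.ext h) fun i hi => ?_
    rw [SimpleGraph.mem_neighborFinset] at hi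
    exact ⟨⟨i, h12 p hp i hi⟩, by simpa using hi.symm, rfl⟩
  · rintro ⟨i, hi⟩ ⟨j, hj⟩
    have : Nonempty V := ⟨i⟩
    obtain ⟨w, hw⟩ := (SimpleGraph.connected_of_ediam_ne_top htop).exists_walk_length_eq_dist i j
    have hle : w.length ≤ 3 := by
      rw [hw, ← hdiam]
      exact SimpleGraph.dist_le_diam htop
    clear hw
    rcases w with _ | ⟨h, _ | ⟨hpq, _ | ⟨hqj, _ | ⟨_, _⟩⟩⟩⟩
    · obtain ⟨p, hp⟩ := (G.degree_pos_iff_exists_adj i).mp (by rw [hdeg2 i hi]; omega)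
      exact ⟨⟨p, h21 i hi p hp⟩, hp, hp⟩
    · exact absurd hj ((hpart j).mp (h21 i hi j h))
    · exact ⟨⟨_, h21 i hi _ h⟩, h, hpq.symm⟩
    · exact absurd hj ((hpart j).mp (h21 _ (h12 _ (h21 i hi _ h) _ hpq) j hqj))
    · simp only [SimpleGraph.Walk.length_cons] at hle
      omega
  · rw [Fintype.card_coe, hcard2, Nat.sub_add_cancel hcube]
    ring
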